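/- arXiv:2603.23016 — 2 statements merged into one kernel-verified Lean document; each statement's English description precedes it below -/
import Mathlib

section
/- (Lemma 1.) Let d ≥ 1 and N ≥ 1, and let p₁,…,p_N and q₁,…,q_N be vectors in ℝ^d (EuclideanSpace ℝ (Fin d)) such that Σ_{i=1}^N p_i = Σ_{i=1}^N q_i (the two datasets have equal means). Then w = 0 is a global maximizer of the logistic-regression log-likelihood L(w) = Σ_{i=1}^N log σ(⟨w, p_i⟩) + Σ_{i=1}^N log(1 − σ(⟨w, q_i⟩)), where σ(t) = 1/(1 + exp(−t)); that is, L(w) ≤ L(0) = −2N·log 2 for every w ∈ ℝ^d. Consequently the maximum-likelihood logistic regressor x ↦ σ(⟨0, x⟩) assigns probability 1/2 to every point, i.e. is the random classifier. -/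
open scoped RealInnerProductSpace

/-- Tangent-line bound at `0` for the concave function `log ∘ σ`. -/
theorem log_logistic_le (t : ℝ) :
    Real.log (1 / (1 + Real.exp (-t))) ≤ t / 2 - Real.log 2 := by
  have h : 2 * Real.exp (-t / 2) ≤ 1 + Real.exp (-t) := by
    have hsq : Real.exp (-t) = Real.exp (-t / 2) ^ 2 := by
      rw [← Real.exp_nat_mul]
      congr 1
      push_cast
      ring
    nlinarith [sq_nonneg (1 - Real.exp (-t / 2))]
  have hlog := Real.log_le_log (by positivity) h
  rw [Real.log_mul two_ne_zero (Real.exp_ne_zero _), Real.log_exp] at hlog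
  rw [one_div, Real.log_inv]
  linarith

theorem one_sub_logistic (t : ℝ) :
    1 - 1 / (1 + Real.exp (-t)) = 1 / (1 + Real.exp (- -t)) := by
  rw [neg_neg, Real.exp_neg]
  have := Real.exp_pos t
  field_simp
  ring

/-- Lemma 1: if the two datasets have equal (summed) means, then `w = 0` is a global
maximizer of the logistic-regression log-likelihood
`L w = Σᵢ log (σ ⟪w, pᵢ⟫) + Σᵢ log (1 - σ ⟪w, qᵢ⟫)`, with `σ t = 1 / (1 + exp (-t))`;
moreover `L 0 = -2N log 2` and the resulting classifier `x ↦ σ ⟪0, x⟫` assigns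
probability `1/2` to every point, i.e. is the random classifier. -/
theorem logistic_regression_zero_is_global_max_of_equal_means
    (d N : ℕ) (hd : 1 ≤ d) (hN : 1 ≤ N)
    (p q : Fin N → EuclideanSpace ℝ (Fin d))
    (hmeans : (∑ i, p i) = ∑ i, q i) :
    (∀ w : EuclideanSpace ℝ (Fin d),
      (∑ i, Real.log (1 / (1 + Real.exp (-⟪w, p i⟫)))) +
        (∑ i, Real.log (1 - 1 / (1 + Real.exp (-⟪w, q i⟫)))) ≤
      (∑ i, Real.log (1 / (1 + Real.exp (-⟪(0 : EuclideanSpace ℝ (Fin d)), p i⟫)))) +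
        (∑ i, Real.log (1 - 1 / (1 + Real.exp (-⟪(0 : EuclideanSpace ℝ (Fin d)), q i⟫))))) ∧
    ((∑ i, Real.log (1 / (1 + Real.exp (-⟪(0 : EuclideanSpace ℝ (Fin d)), p i⟫)))) +
        (∑ i, Real.log (1 - 1 / (1 + Real.exp (-⟪(0 : EuclideanSpace ℝ (Fin d)), q i⟫)))) =
      -(2 * (N : ℝ) * Real.log 2)) ∧
    (∀ x : EuclideanSpace ℝ (Fin d),
      1 / (1 + Real.exp (-⟪(0 : EuclideanSpace ℝ (Fin d)), x⟫)) = 1 / 2) := by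
  have hzero :
      (∑ i, Real.log (1 / (1 + Real.exp (-⟪(0 : EuclideanSpace ℝ (Fin d)), p i⟫)))) +
        (∑ i, Real.log (1 - 1 / (1 + Real.exp (-⟪(0 : EuclideanSpace ℝ (Fin d)), q i⟫)))) =
      -(2 * (N : ℝ) * Real.log 2) := by
    have hhalf : (1 : ℝ) - 2⁻¹ = 2⁻¹ := by norm_num
    have hhalf' : (1 : ℝ) / (1 + 1) = 2⁻¹ := by norm_num
    simp only [inner_zero_left, neg_zero, Real.exp_zero, hhalf, hhalf', Real.log_inv,
      Finset.sum_const, Finset.card_univ, Fintype.card_fin, nsmul_eq_mul]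
    ring
  refine ⟨fun w => ?_, hzero, fun x => ?_⟩
  · rw [hzero]
    have hinner : ∑ i, ⟪w, p i⟫ = ∑ i, ⟪w, q i⟫ := by
      rw [← inner_sum, hmeans, inner_sum]
    simp only [one_sub_logistic]
    calc
      _ ≤ ∑ i, (⟪w, p i⟫ / 2 - Real.log 2) + ∑ i, (-⟪w, q i⟫ / 2 - Real.log 2) :=
        add_le_add (Finset.sum_le_sum fun i _ => log_logistic_le _)
          (Finset.sum_le_sum fun i _ => log_logistic_le _)
      _ = -(2 * (N : ℝ) * Real.log 2) := by
        simp only [Finset.sum_sub_distrib, ← Finset.sum_div, Finset.sum_neg_distrib, hinner,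
          Finset.sum_const, Finset.card_univ, Fintype.card_fin, nsmul_eq_mul]
        ring
  · norm_num [inner_zero_left]
end

section
/- Let d ≥ 1 and N ≥ 1, and let p₁,…,p_N and q₁,…,q_N be vectors in ℝ^d (EuclideanSpace ℝ (Fin d)). If w = 0 is a global maximizer of the logistic-regression log-likelihood L(w) = Σ_{i=1}^N log σ(⟨w, p_i⟩) + Σ_{i=1}^N log(1 − σ(⟨w, q_i⟩)), where σ(t) = 1/(1 + exp(−t)), then Σ_{i=1}^N p_i = Σ_{i=1}^N q_i. (Converse of Lemma 1: the zero-weight classifier can only be maximum-likelihood when the two datasets have equal means.) -/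
open scoped RealInnerProductSpace

/-- Along the line `t ↦ t * a`, the log-sigmoid has derivative `a / 2` at `0`. -/
theorem hasDerivAt_log_sigmoid_mul_zero (a : ℝ) :
    HasDerivAt (fun t : ℝ => Real.log (1 / (1 + Real.exp (-(t * a))))) (a / 2) 0 := by
  have h : HasDerivAt (fun t : ℝ => Real.sigmoid (t * a)) (1 / 4 * a) 0 := by
    refine ((Real.hasDerivAt_sigmoid (0 * a)).comp (0 : ℝ)
      ((hasDerivAt_id (0 : ℝ)).mul_const a)).congr_deriv ?_
    norm_num [Real.sigmoid_zero]
  convert h.log (Real.sigmoid_pos _).ne' using 1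
  · simp [Real.sigmoid_def]
  · norm_num [Real.sigmoid_zero]
    ring

/-- Along the line `t ↦ t * a`, `log (1 - σ)` has derivative `-a / 2` at `0`. -/
theorem hasDerivAt_log_one_sub_sigmoid_mul_zero (a : ℝ) :
    HasDerivAt (fun t : ℝ => Real.log (1 - 1 / (1 + Real.exp (-(t * a))))) (-a / 2) 0 := by
  convert hasDerivAt_log_sigmoid_mul_zero (-a) using 4 with t
  rw [mul_neg, neg_neg, Real.exp_neg]
  have := Real.exp_pos (t * a)
  field_simp
  ring

/-- Converse of Lemma 1: if `w = 0` is a global maximizer of the logistic-regression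
log-likelihood `L w = Σᵢ log (σ ⟪w, pᵢ⟫) + Σᵢ log (1 - σ ⟪w, qᵢ⟫)`, with
`σ t = 1 / (1 + exp (-t))`, then the two datasets have equal sums. -/
theorem equal_means_of_zero_global_max_logistic_regression
    (d N : ℕ) (hd : 1 ≤ d) (hN : 1 ≤ N)
    (p q : Fin N → EuclideanSpace ℝ (Fin d))
    (hmax : ∀ w : EuclideanSpace ℝ (Fin d),
      (∑ i, Real.log (1 / (1 + Real.exp (-⟪w, p i⟫)))) +
        (∑ i, Real.log (1 - 1 / (1 + Real.exp (-⟪w, q i⟫)))) ≤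
      (∑ i, Real.log (1 / (1 + Real.exp (-⟪(0 : EuclideanSpace ℝ (Fin d)), p i⟫)))) +
        (∑ i, Real.log (1 - 1 / (1 + Real.exp (-⟪(0 : EuclideanSpace ℝ (Fin d)), q i⟫))))) :
    (∑ i, p i) = ∑ i, q i := by
  set v := (∑ i, p i) - ∑ i, q i with hv
  have hderiv := (HasDerivAt.fun_sum fun i (_ : i ∈ Finset.univ) =>
    hasDerivAt_log_sigmoid_mul_zero ⟪v, p i⟫).fun_add
    (HasDerivAt.fun_sum fun i (_ : i ∈ Finset.univ) =>
      hasDerivAt_log_one_sub_sigmoid_mul_zero ⟪v, q i⟫)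
  have hzero := IsLocalMax.hasDerivAt_eq_zero (Filter.Eventually.of_forall fun t => by
    simpa [real_inner_smul_left] using hmax (t • v)) hderiv
  have hvv : ⟪v, v⟫ = 0 := by
    have : ⟪v, v⟫ = (∑ i, ⟪v, p i⟫) - ∑ i, ⟪v, q i⟫ := by
      conv_lhs => rw [hv, inner_sub_right, inner_sum, inner_sum, ← hv]
    rw [← Finset.sum_div, ← Finset.sum_div, Finset.sum_neg_distrib] at hzero
    linarith
  exact sub_eq_zero.mp (inner_self_eq_zero.mp hvv)
end
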